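/- Let Ω be a domain in ℝ^N, N ≥ 1, and define μ(Ω) := inf{∫_Ω|∇φ|² dx / ∫_Ω|x|^{−2}φ² dx : φ ∈ C_c^∞(Ω), φ ≢ 0}. If c > μ(Ω), then there is no nonnegative, not almost everywhere zero, u ∈ L¹_loc(Ω) with |x|^{−2}u ∈ L¹_loc(Ω) satisfying −Δu − c|x|^{−2}u ≥ 0 in the sense of distributions on Ω, i.e. satisfying ∫_Ω u(−Δφ − c|x|^{−2}φ) dx ≥ 0 for every nonnegative φ ∈ C_c^∞(Ω). -/

import Mathlib

open MeasureTheory Metric Filter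
open scoped Topology ENNReal NNReal RealInnerProductSpace

noncomputable section

/-- `ℝ^N` as a Euclidean space. -/
abbrev Euc (N : ℕ) : Type := EuclideanSpace ℝ (Fin N)

/-- `φ ∈ C_c^∞(Ω)`: smooth functions with compact support contained in `Ω`. -/
def IsTestFun {N : ℕ} (Ω : Set (Euc N)) (φ : Euc N → ℝ) : Prop :=
  ContDiff ℝ (⊤ : ℕ∞) φ ∧ HasCompactSupport φ ∧ tsupport φ ⊆ Ω

/-- The classical Laplacian of `φ` at `x`: the sum of the pure second partial derivatives. -/
def lap {N : ℕ} (φ : Euc N → ℝ) (x : Euc N) : ℝ :=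
  ∑ i : Fin N, iteratedFDeriv ℝ 2 φ x ![EuclideanSpace.single i 1, EuclideanSpace.single i 1]

/-- The best constant `μ(Ω)` in the Hardy inequality on `Ω` with the weight `|x|⁻²`. -/
def hardyConst {N : ℕ} (Ω : Set (Euc N)) : ℝ :=
  sInf {t : ℝ | ∃ φ : Euc N → ℝ, IsTestFun Ω φ ∧ φ ≠ 0 ∧
    t = (∫ x in Ω, ‖gradient φ x‖ ^ 2) / (∫ x in Ω, ‖x‖ ^ (-2 : ℝ) * φ x ^ 2)}

abbrev ee {N : ℕ} (i : Fin N) : Euc N := EuclideanSpace.single i 1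

def pd {N : ℕ} (i : Fin N) (φ : Euc N → ℝ) (x : Euc N) : ℝ := fderiv ℝ φ x (ee i)

lemma lap_eq {N : ℕ} {φ : Euc N → ℝ} (h : ContDiff ℝ (⊤ : ℕ∞) φ) (x : Euc N) :
    lap φ x = ∑ i, pd i (pd i φ) x := by
  unfold lap
  refine Finset.sum_congr rfl fun i _ => ?_
  rw [iteratedFDeriv_two_apply]
  have hd : DifferentiableAt ℝ (fderiv ℝ φ) x :=
    ((h.fderiv_right (m := (⊤ : ℕ∞)) (by simp)).differentiable (by simp)) x
  simp only [Matrix.cons_val_zero, Matrix.cons_val_one]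
  unfold pd
  have := (hd.hasFDerivAt.clm_apply (hasFDerivAt_const (ee i) x)).fderiv
  rw [this]
  simp

lemma pd_contDiff {N : ℕ} {φ : Euc N → ℝ} (i : Fin N) (h : ContDiff ℝ (⊤ : ℕ∞) φ) :
    ContDiff ℝ (⊤ : ℕ∞) (pd i φ) := by
  unfold pd
  exact (h.fderiv_right (m := (⊤ : ℕ∞)) (by simp)).clm_apply contDiff_const

lemma pd_compact {N : ℕ} {φ : Euc N → ℝ} (i : Fin N) (h : HasCompactSupport φ) :
    HasCompactSupport (pd i φ) := h.fderiv_apply (𝕜 := ℝ) (ee i)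

lemma lap_contDiff {N : ℕ} {φ : Euc N → ℝ} (h : ContDiff ℝ (⊤ : ℕ∞) φ) :
    ContDiff ℝ (⊤ : ℕ∞) (lap φ) := by
  have : lap φ = fun x => ∑ i, pd i (pd i φ) x := funext (lap_eq h)
  rw [this]
  exact ContDiff.sum fun i _ => pd_contDiff i (pd_contDiff i h)

lemma lap_zero_of_notMem {N : ℕ} {φ : Euc N → ℝ} {x : Euc N} (hx : x ∉ tsupport φ) :
    lap φ x = 0 := by
  unfold lap
  refine Finset.sum_eq_zero fun i _ => ?_
  have : x ∉ tsupport (iteratedFDeriv ℝ 2 φ) := fun h => hx (tsupport_iteratedFDeriv_subset 2 h)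
  rw [image_eq_zero_of_notMem_tsupport this]; simp

lemma lap_compact {N : ℕ} {φ : Euc N → ℝ} (h : HasCompactSupport φ) :
    HasCompactSupport (lap φ) := by
  refine h.mono' ?_
  intro x hx
  by_contra hh
  exact hx (lap_zero_of_notMem hh)

/-- the basic one-dimensional profile derivative -/
def kk : ℝ → ℝ := deriv expNegInvGlue

lemma kk_contDiff : ContDiff ℝ (⊤ : ℕ∞) kk := by
  have h : ContDiff ℝ (⊤ : ℕ∞) expNegInvGlue := expNegInvGlue.contDiff
  exact ContDiff.iterate_deriv 1 h

lemma hasDerivAt_glue (t : ℝ) : HasDerivAt expNegInvGlue (kk t) t := by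
  have h : ContDiff ℝ (⊤ : ℕ∞) expNegInvGlue := expNegInvGlue.contDiff
  exact (h.differentiable (by simp) t).hasDerivAt

lemma hasDerivAt_kk (t : ℝ) : HasDerivAt kk (deriv kk t) t :=
  (kk_contDiff.differentiable (by simp) t).hasDerivAt

lemma kk_of_nonpos {t : ℝ} (ht : t ≤ 0) : kk t = 0 := by
  have : IsLocalMin expNegInvGlue t := by
    refine Filter.Eventually.of_forall fun y => ?_
    rw [expNegInvGlue.zero_of_nonpos ht]
    exact expNegInvGlue.nonneg y
  exact this.deriv_eq_zero

lemma kk_pos {t : ℝ} (ht : 0 < t) : 0 < kk t := by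
  have h1 : HasDerivAt (fun x : ℝ => Real.exp (-x⁻¹)) (Real.exp (-t⁻¹) * (-(-(t^2)⁻¹))) t :=
    ((hasDerivAt_inv ht.ne').neg).exp
  have h2 : expNegInvGlue =ᶠ[𝓝 t] (fun x : ℝ => Real.exp (-x⁻¹)) := by
    filter_upwards [lt_mem_nhds ht] with x hx
    simp [expNegInvGlue, not_le.2 hx]
  have h3 := (h1.congr_of_eventuallyEq h2).deriv
  unfold kk
  rw [h3]
  rw [neg_neg]; positivity

lemma kk_nonneg (t : ℝ) : 0 ≤ kk t := by
  rcases le_or_gt t 0 with h | h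
  · rw [kk_of_nonpos h]
  · exact (kk_pos h).le

/-- radial test function -/
def PsiF {N : ℕ} (x0 : Euc N) (s : ℝ) (y : Euc N) : ℝ :=
  expNegInvGlue (1 - ‖y - x0‖ ^ 2 / s ^ 2)

lemma hasFDerivAt_q {N : ℕ} (x0 : Euc N) (s : ℝ) (y : Euc N) :
    HasFDerivAt (fun y : Euc N => 1 - ‖y - x0‖ ^ 2 / s ^ 2)
      (-((s^2)⁻¹ • (2 • (innerSL ℝ (y - x0))))) y := by
  have h := ((hasFDerivAt_id y).sub_const x0).norm_sq
  have h2 := (h.const_smul ((s^2)⁻¹)).const_sub 1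
  have e : (fun y : Euc N => 1 - ‖y - x0‖ ^ 2 / s ^ 2) =
      (fun x => 1 - ((s ^ 2)⁻¹ • fun x : Euc N => ‖id x - x0‖ ^ 2) x) := by
    ext z; simp [div_eq_inv_mul]
  rw [e]
  exact h2
  
lemma PsiF_contDiff {N : ℕ} (x0 : Euc N) (s : ℝ) : ContDiff ℝ (⊤ : ℕ∞) (PsiF x0 s) := by
  have h : ContDiff ℝ (⊤ : ℕ∞) expNegInvGlue := expNegInvGlue.contDiff
  refine h.comp ?_
  exact contDiff_const.sub (((contDiff_id.sub contDiff_const).norm_sq ℝ).div_const _)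

lemma lap_PsiF {N : ℕ} (x0 : Euc N) (s : ℝ) (y : Euc N) :
    lap (PsiF x0 s) y = 4 * ‖y - x0‖ ^ 2 / s ^ 4 * deriv kk (1 - ‖y - x0‖ ^ 2 / s ^ 2)
      - 2 * N / s ^ 2 * kk (1 - ‖y - x0‖ ^ 2 / s ^ 2) := by
  rw [lap_eq (PsiF_contDiff x0 s)]
  have h1 : ∀ i : Fin N, pd i (PsiF x0 s) =
      fun y => kk (1 - ‖y - x0‖ ^ 2 / s ^ 2) * (-(2 / s^2 * (y - x0) i)) := by
    intro i
    ext y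
    have := (hasDerivAt_glue (1 - ‖y - x0‖ ^ 2 / s ^ 2)).comp_hasFDerivAt y (hasFDerivAt_q x0 s y)
    unfold pd
    have h2 := this.fderiv
    unfold PsiF
    rw [show (fun y => expNegInvGlue (1 - ‖y - x0‖ ^ 2 / s ^ 2)) =
      expNegInvGlue ∘ (fun y : Euc N => 1 - ‖y - x0‖ ^ 2 / s ^ 2) from rfl, h2]
    simp [EuclideanSpace.inner_single_right]
    ring_nf; simp
  have h3 : ∀ i : Fin N, pd i (pd i (PsiF x0 s)) y =
     4 * ((y - x0) i)^2 / s ^ 4 * deriv kk (1 - ‖y - x0‖ ^ 2 / s ^ 2)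
      - 2 / s ^ 2 * kk (1 - ‖y - x0‖ ^ 2 / s ^ 2) := by
    intro i
    rw [h1]
    have a1 := (hasDerivAt_kk (1 - ‖y - x0‖ ^ 2 / s ^ 2)).comp_hasFDerivAt y (hasFDerivAt_q x0 s y)
    have a2 : HasFDerivAt (fun y : Euc N => (-(2 / s^2 * (y - x0) i)))
        (-((2/s^2) • (EuclideanSpace.proj i : Euc N →L[ℝ] ℝ))) y := by
      have := ((EuclideanSpace.proj i : Euc N →L[ℝ] ℝ).hasFDerivAt (x := y - x0)).comp y
        ((hasFDerivAt_id y).sub_const x0)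
      exact (this.const_smul (2/s^2)).neg
    have := (a1.mul a2).fderiv
    unfold pd
    erw [this]
    simp [EuclideanSpace.inner_single_right]
    ring
  simp_rw [h3]
  rw [Finset.sum_sub_distrib, ← Finset.sum_mul, ← Finset.sum_div, ← Finset.mul_sum,
    ← EuclideanSpace.real_norm_sq_eq]
  simp; ring

lemma PsiF_support {N : ℕ} (x0 : Euc N) {s : ℝ} (hs : 0 < s) :
    tsupport (PsiF x0 s) ⊆ closedBall x0 s := by
  refine closure_minimal ?_ isClosed_closedBall
  intro y hy
  by_contra h
  apply hy
  unfold PsiF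
  apply expNegInvGlue.zero_of_nonpos
  rw [mem_closedBall, dist_eq_norm, not_le] at h
  rw [sub_nonpos, le_div_iff₀ (by positivity), one_mul]
  gcongr

lemma PsiF_test {N : ℕ} {Ω : Set (Euc N)} (x0 : Euc N) {s : ℝ} (hs : 0 < s)
    (h : closedBall x0 s ⊆ Ω) : IsTestFun Ω (PsiF x0 s) :=
  ⟨PsiF_contDiff x0 s, (isCompact_closedBall x0 s).of_isClosed_subset (isClosed_tsupport _) (PsiF_support x0 hs),
    (PsiF_support x0 hs).trans h⟩

lemma int_mul {N : ℕ} {f h : Euc N → ℝ} (hf : Integrable f) (hh : Continuous h)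
    (hc : HasCompactSupport h) : Integrable (fun x => f x * h x) := by
  obtain ⟨C, hC⟩ := hc.exists_bound_of_continuous hh
  exact hf.mul_bdd (c := C) hh.aestronglyMeasurable (Eventually.of_forall hC)

def cutF {N : ℕ} (K : Set (Euc N)) (u : Euc N → ℝ) : Euc N → ℝ :=
  K.indicator (fun x => |u x|)

lemma cutF_int {N : ℕ} {Ω K : Set (Euc N)} {u : Euc N → ℝ}
    (hK : IsCompact K) (hKΩ : K ⊆ Ω) (hu : LocallyIntegrableOn u Ω volume) :
    Integrable (cutF K u) := by
  have := (hu.integrableOn_compact_subset hKΩ hK).abs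
  exact (integrable_indicator_iff hK.measurableSet).2 this

lemma cutF_nonneg {N : ℕ} (K : Set (Euc N)) (u : Euc N → ℝ) (x : Euc N) : 0 ≤ cutF K u x :=
  Set.indicator_nonneg (fun _ _ => abs_nonneg _) x

lemma key_ineq {N : ℕ} {Ω K : Set (Euc N)} {u : Euc N → ℝ} {c : ℝ}
    (hΩo : IsOpen Ω) (hK : IsCompact K) (hKΩ : K ⊆ Ω)
    (hu : LocallyIntegrableOn u Ω volume)
    (hV : LocallyIntegrableOn (fun x => ‖x‖ ^ (-2 : ℝ) * u x) Ω volume)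
    (hpos : ∀ᵐ x ∂volume, x ∈ Ω → 0 ≤ u x)
    (hsup : ∀ φ : Euc N → ℝ, IsTestFun Ω φ → (∀ x, 0 ≤ φ x) →
        0 ≤ ∫ x in Ω, u x * (-(lap φ x) - c * ‖x‖ ^ (-2 : ℝ) * φ x))
    {ψ : Euc N → ℝ} (h1 : ContDiff ℝ (⊤ : ℕ∞) ψ) (h2 : tsupport ψ ⊆ K) (h3 : ∀ x, 0 ≤ ψ x) :
    ∫ x, cutF K u x * lap ψ x ≤
      -(c * ∫ x, cutF K (fun x => ‖x‖ ^ (-2 : ℝ) * u x) x * ψ x) := by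
  have hcs : HasCompactSupport ψ := hK.of_isClosed_subset (isClosed_tsupport _) h2
  have h := hsup ψ ⟨h1, hcs, h2.trans hKΩ⟩ h3
  have e : ∫ x in Ω, u x * (-(lap ψ x) - c * ‖x‖ ^ (-2 : ℝ) * ψ x) =
      ∫ x, (-(cutF K u x * lap ψ x) - c * (cutF K (fun x => ‖x‖ ^ (-2 : ℝ) * u x) x * ψ x)) := by
    rw [← integral_indicator hΩo.measurableSet]
    refine integral_congr_ae ?_
    filter_upwards [hpos] with x hx
    by_cases hxK : x ∈ K
    · have hxΩ := hKΩ hxK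
      have hp := hx hxΩ
      have hv : 0 ≤ ‖x‖ ^ (-2 : ℝ) * u x := by positivity
      simp only [cutF, Set.indicator_of_mem hxΩ, Set.indicator_of_mem hxK, abs_of_nonneg hp,
        abs_of_nonneg hv]
      ring
    · have hn : x ∉ tsupport ψ := fun h => hxK (h2 h)
      simp [cutF, Set.indicator, hxK, lap_zero_of_notMem hn, image_eq_zero_of_notMem_tsupport hn]
  rw [e, integral_sub, integral_neg, integral_const_mul] at h
  · linarith
  · exact (int_mul (cutF_int hK hKΩ hu) (lap_contDiff h1).continuous (lap_compact hcs)).neg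
  · exact (int_mul (cutF_int hK hKΩ hV) h1.continuous hcs).const_mul c

/-- the monotone averaging kernel -/
def avK {N : ℕ} (x0 : Euc N) (s : ℝ) (y : Euc N) : ℝ :=
  (s ^ N)⁻¹ * (2 * kk (1 - ‖y - x0‖ ^ 2 / s ^ 2))

def avKD {N : ℕ} (x0 : Euc N) (s : ℝ) (y : Euc N) : ℝ :=
  s * (s ^ N)⁻¹ * lap (PsiF x0 s) y

lemma avK_deriv {N : ℕ} (x0 : Euc N) {s : ℝ} (hs : 0 < s) (y : Euc N) :
    HasDerivAt (fun s => avK x0 s y) (avKD x0 s y) s := by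
  unfold avK avKD
  rw [lap_PsiF]
  have a : HasDerivAt (fun s : ℝ => 1 - ‖y - x0‖ ^ 2 / s ^ 2) (2 * ‖y - x0‖ ^ 2 / s ^ 3) s := by
    have := ((hasDerivAt_pow 2 s).fun_inv (by positivity)).const_mul (‖y - x0‖ ^ 2)
    have := this.const_sub 1
    simp only [div_eq_mul_inv]
    refine this.congr_deriv ?_
    norm_num
    field_simp
  have b := ((hasDerivAt_kk (1 - ‖y - x0‖ ^ 2 / s ^ 2)).comp s a).const_mul 2
  have d := (hasDerivAt_pow N s).fun_inv (by positivity)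
  have := d.mul b
  refine this.congr_deriv ?_
  simp only [Function.comp]
  generalize kk (1 - ‖y - x0‖ ^ 2 / s ^ 2) = A
  generalize deriv kk (1 - ‖y - x0‖ ^ 2 / s ^ 2) = B
  rcases N with _ | n
  · simp; field_simp; ring
  · simp only [Nat.add_sub_cancel]
    field_simp
    ring

lemma avKD_cont {N : ℕ} (x0 : Euc N) :
    ContinuousOn (fun p : ℝ × Euc N => avKD x0 p.1 p.2) (Set.Ioi 0 ×ˢ Set.univ) := by
  unfold avKD
  simp_rw [lap_PsiF]
  have hk : Continuous kk := kk_contDiff.continuous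
  have hk' : Continuous (deriv kk) := kk_contDiff.continuous_deriv (by simp)
  have h0 : ∀ p ∈ (Set.Ioi (0:ℝ) ×ˢ (Set.univ : Set (Euc N))), p.1 ≠ 0 := by
    rintro p ⟨hp, _⟩; exact (ne_of_gt hp)
  have hq : ContinuousOn (fun p : ℝ × Euc N => 1 - ‖p.2 - x0‖ ^ 2 / p.1 ^ 2) (Set.Ioi 0 ×ˢ Set.univ) := by
    refine continuousOn_const.sub (ContinuousOn.div (by fun_prop) (by fun_prop) ?_)
    intro p hp; exact pow_ne_zero _ (h0 p hp)
  refine ContinuousOn.mul (ContinuousOn.mul (by fun_prop) (ContinuousOn.inv₀ (by fun_prop) fun p hp => pow_ne_zero _ (h0 p hp))) ?_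
  refine ContinuousOn.sub (ContinuousOn.mul (ContinuousOn.div (by fun_prop) (by fun_prop) fun p hp => pow_ne_zero _ (h0 p hp)) ?_) (ContinuousOn.mul (ContinuousOn.div (by fun_prop) (by fun_prop) fun p hp => pow_ne_zero _ (h0 p hp)) ?_)
  · exact hk'.comp_continuousOn hq
  · exact hk.comp_continuousOn hq

lemma avK_cont {N : ℕ} (x0 : Euc N) (s : ℝ) : Continuous (avK x0 s) := by
  have hk : Continuous kk := kk_contDiff.continuous
  unfold avK
  fun_prop

lemma avK_zero {N : ℕ} (x0 : Euc N) {s : ℝ} (hs : 0 < s) {y : Euc N} (hy : y ∉ closedBall x0 s) :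
    avK x0 s y = 0 := by
  unfold avK
  rw [kk_of_nonpos]; · simp
  rw [mem_closedBall, dist_eq_norm, not_le] at hy
  rw [sub_nonpos, le_div_iff₀ (by positivity), one_mul]
  gcongr

lemma avK_compact {N : ℕ} (x0 : Euc N) {s : ℝ} (hs : 0 < s) : HasCompactSupport (avK x0 s) :=
  HasCompactSupport.intro (isCompact_closedBall x0 s) fun _ hy => avK_zero x0 hs hy

lemma avK_nonneg {N : ℕ} (x0 : Euc N) {s : ℝ} (hs : 0 < s) (y : Euc N) : 0 ≤ avK x0 s y := by
  unfold avK
  have := kk_nonneg (1 - ‖y - x0‖ ^ 2 / s ^ 2)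
  positivity

lemma avK_pos {N : ℕ} (x0 : Euc N) {s : ℝ} (hs : 0 < s) {y : Euc N} (hy : y ∈ ball x0 s) :
    0 < avK x0 s y := by
  unfold avK
  have := kk_pos (t := 1 - ‖y - x0‖ ^ 2 / s ^ 2) (by
    rw [mem_ball, dist_eq_norm] at hy
    rw [sub_pos, div_lt_one (by positivity)]
    gcongr)
  positivity

lemma mean_deriv {N : ℕ} {f : Euc N → ℝ} (hf : Integrable f) (x0 : Euc N) {R : ℝ}
    (hfR : ∀ y ∉ closedBall x0 R, f y = 0) {s : ℝ} (hs : 0 < s) :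
    HasDerivAt (fun s => ∫ y, f y * avK x0 s y) (∫ y, f y * avKD x0 s y) s := by
  have hcomp : IsCompact (Set.Icc (s/2) (2*s) ×ˢ closedBall x0 R) :=
    isCompact_Icc.prod (isCompact_closedBall x0 R)
  obtain ⟨C, hC⟩ := hcomp.exists_bound_of_continuousOn ((avKD_cont x0).mono (by
    rintro ⟨a, b⟩ ⟨h1, h2⟩
    exact ⟨lt_of_lt_of_le (by simpa using hs) h1.1, trivial⟩))
  refine (hasDerivAt_integral_of_dominated_loc_of_deriv_le (s := Set.Icc (s/2) (2*s))
    (F := fun s y => f y * avK x0 s y) (F' := fun s y => f y * avKD x0 s y)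
    (bound := fun y => |f y| * C)
    (Icc_mem_nhds (by linarith) (by linarith)) ?_ ?_ ?_ ?_ ?_ ?_).2
  · exact Eventually.of_forall fun t => hf.aestronglyMeasurable.mul (avK_cont x0 t).aestronglyMeasurable
  · exact int_mul hf (avK_cont x0 s) (avK_compact x0 hs)
  · refine hf.aestronglyMeasurable.mul ?_
    exact ((lap_contDiff (PsiF_contDiff x0 s)).continuous.const_smul (s * (s ^ N)⁻¹)).aestronglyMeasurable
  · refine Eventually.of_forall fun y t ht => ?_
    rw [norm_mul, Real.norm_eq_abs]
    by_cases hy : y ∈ closedBall x0 R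
    · exact mul_le_mul_of_nonneg_left (hC (t, y) ⟨ht, hy⟩) (abs_nonneg _)
    · simp [hfR y hy]
  · exact hf.abs.mul_const C
  · refine Eventually.of_forall fun y t ht => ?_
    exact (avK_deriv x0 (lt_of_lt_of_le (by linarith) ht.1) y).const_mul (f y)

lemma mean_zero {N : ℕ} {Ω : Set (Euc N)} {u : Euc N → ℝ} {c : ℝ} (hc : 0 < c)
    (hΩo : IsOpen Ω)
    (hu : LocallyIntegrableOn u Ω volume)
    (hV : LocallyIntegrableOn (fun x => ‖x‖ ^ (-2 : ℝ) * u x) Ω volume)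
    (hpos : ∀ᵐ x ∂volume, x ∈ Ω → 0 ≤ u x)
    (hsup : ∀ φ : Euc N → ℝ, IsTestFun Ω φ → (∀ x, 0 ≤ φ x) →
        0 ≤ ∫ x in Ω, u x * (-(lap φ x) - c * ‖x‖ ^ (-2 : ℝ) * φ x))
    {x0 : Euc N} {R : ℝ} (hR : 0 < R) (hB : closedBall x0 R ⊆ Ω)
    (hL : Tendsto (fun r => ⨍ y in closedBall x0 r, |u y|) (𝓝[>] 0) (𝓝 0)) :
    ∀ᵐ y ∂volume, y ∈ ball x0 R → u y = 0 := by
  have hK := isCompact_closedBall x0 R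
  set f := cutF (closedBall x0 R) u with hf_def
  have hf : Integrable f := cutF_int hK hB hu
  have hf0 : ∀ y, 0 ≤ f y := cutF_nonneg _ _
  have hfR : ∀ y ∉ closedBall x0 R, f y = 0 := fun y hy => Set.indicator_of_notMem hy _
  set F : ℝ → ℝ := fun s => ∫ y, f y * avK x0 s y with hF
  have hder : ∀ s, 0 < s → HasDerivAt F (∫ y, f y * avKD x0 s y) s :=
    fun s hs => mean_deriv hf x0 hfR hs
  have hanti : AntitoneOn F (Set.Ioc 0 R) := by
    refine antitoneOn_of_deriv_nonpos (convex_Ioc 0 R) ?_ ?_ ?_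
    · exact fun s hs => (hder s hs.1).continuousAt.continuousWithinAt
    · rw [interior_Ioc]
      exact fun s hs => (hder s hs.1).differentiableAt.differentiableWithinAt
    · rw [interior_Ioc]
      intro s hs
      rw [(hder s hs.1).deriv]
      have hs0 := hs.1
      have h1 := key_ineq hΩo hK hB hu hV hpos hsup (PsiF_contDiff x0 s)
        ((PsiF_support x0 hs.1).trans (closedBall_subset_closedBall hs.2.le))
        (fun x => expNegInvGlue.nonneg _)
      have h2 : 0 ≤ ∫ x, cutF (closedBall x0 R) (fun x => ‖x‖ ^ (-2 : ℝ) * u x) x * PsiF x0 s x :=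
        integral_nonneg fun x => mul_nonneg (cutF_nonneg _ _ _) (expNegInvGlue.nonneg _)
      have h3 : ∫ y, f y * avKD x0 s y = s * (s ^ N)⁻¹ * ∫ y, f y * lap (PsiF x0 s) y := by
        rw [← integral_const_mul]
        congr 1; ext y; unfold avKD; ring
      rw [h3]
      refine mul_nonpos_of_nonneg_of_nonpos (by positivity) ?_
      have := mul_nonneg hc.le h2
      linarith
  obtain ⟨M, hM⟩ := (isCompact_Icc (a := (0:ℝ)) (b := 1)).exists_bound_of_continuousOn
    (kk_contDiff.continuous.continuousOn)
  have hM' : ∀ t ≤ 1, kk t ≤ M := by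
    intro t ht
    rcases le_or_gt t 0 with h | h
    · rw [kk_of_nonpos h]
      exact (norm_nonneg _).trans (hM 0 (by simp))
    · exact (le_abs_self _).trans (hM t ⟨h.le, ht⟩)
  set b := volume.real (ball (0 : Euc N) 1)
  have hb : 0 < b := by
    refine ENNReal.toReal_pos (measure_ball_pos _ _ one_pos).ne' measure_ball_lt_top.ne
  have hFle : ∀ s ∈ Set.Ioc 0 R, F s ≤ (2 * M * b) * ⨍ y in closedBall x0 s, |u y| := by
    intro s hs
    have hs0 := hs.1
    have hv : volume.real (closedBall x0 s) = s ^ N * b := by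
      rw [Measure.addHaar_real_closedBall _ _ hs0.le]; simp [b]
    rw [setAverage_eq, hv]
    have hIu : IntegrableOn (fun y => |u y|) (closedBall x0 s) :=
      (hu.integrableOn_compact_subset ((closedBall_subset_closedBall hs.2).trans hB)
        (isCompact_closedBall x0 s)).abs
    have : F s ≤ ∫ y, ((s^N)⁻¹ * (2 * M)) * (closedBall x0 s).indicator (fun y => |u y|) y := by
      refine integral_mono (int_mul hf (avK_cont x0 s) (avK_compact x0 hs0)) ?_ ?_
      · exact ((integrable_indicator_iff isClosed_closedBall.measurableSet).2 hIu).const_mul _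
      · intro y
        by_cases hy : y ∈ closedBall x0 s
        · have hy' : y ∈ closedBall x0 R := closedBall_subset_closedBall hs.2 hy
          simp only [hf_def, cutF, Set.indicator_of_mem hy, Set.indicator_of_mem hy', avK]
          rw [mul_comm]
          gcongr
          refine hM' _ ?_
          have : 0 ≤ ‖y - x0‖ ^ 2 / s ^ 2 := by positivity
          linarith
        · simp [avK_zero x0 hs0 hy, hy]
    refine this.trans (le_of_eq ?_)
    rw [integral_const_mul, integral_indicator isClosed_closedBall.measurableSet]
    simp only [smul_eq_mul]
    field_simp
  have hFR : F R ≤ 0 := by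
    have hlim : Tendsto (fun s => (2 * M * b) * ⨍ y in closedBall x0 s, |u y|) (𝓝[>] 0) (𝓝 0) := by
      simpa using hL.const_mul (2 * M * b)
    refine ge_of_tendsto hlim ?_
    filter_upwards [Ioc_mem_nhdsGT hR] with s hs
    exact (hanti hs ⟨hR, le_rfl⟩ hs.2).trans (hFle s hs)
  have hnn : ∀ y, 0 ≤ f y * avK x0 R y := fun y => mul_nonneg (hf0 y) (avK_nonneg x0 hR y)
  have hz := (integral_eq_zero_iff_of_nonneg hnn
    (int_mul hf (avK_cont x0 R) (avK_compact x0 hR))).1 (le_antisymm hFR (integral_nonneg hnn))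
  filter_upwards [hz] with y hy hyb
  have := (mul_eq_zero.1 hy).resolve_right (avK_pos x0 hR hyb).ne'
  simpa [hf_def, cutF, Set.indicator_of_mem (ball_subset_closedBall hyb)] using this

lemma leb_points {N : ℕ} {Ω : Set (Euc N)} {u : Euc N → ℝ}
    (hΩo : IsOpen Ω) (hu : LocallyIntegrableOn u Ω volume) :
    ∀ᵐ x ∂volume, x ∈ Ω → Tendsto (fun r => ⨍ y in closedBall x r, |u y|) (𝓝[>] 0) (𝓝 |u x|) := by
  rw [ae_iff]
  refine measure_null_of_locally_null _ fun a ha => ?_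
  have haΩ : a ∈ Ω := by
    by_contra h
    exact ha fun h' => absurd h' h
  obtain ⟨R, hR, hB⟩ := Metric.nhds_basis_closedBall.mem_iff.1 (hΩo.mem_nhds haΩ)
  have hf : Integrable (cutF (closedBall a R) u) := cutF_int (isCompact_closedBall a R) hB hu
  have h := IsUnifLocDoublingMeasure.ae_tendsto_average (μ := volume) hf.locallyIntegrable 1
  refine ⟨_, inter_mem_nhdsWithin _ (ball_mem_nhds a hR), ?_⟩
  refine measure_mono_null ?_ (ae_iff.1 h)
  rintro x ⟨hx1, hx2⟩ hx3
  apply hx1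
  intro _
  have h4 := hx3 (fun _ : ℝ => x) (fun r => r) (l := 𝓝[>] 0) tendsto_id (by
    filter_upwards [self_mem_nhdsWithin] with r hr
    have : (0:ℝ) < r := hr
    simp [this.le])
  have e : cutF (closedBall a R) u x = |u x| := Set.indicator_of_mem (ball_subset_closedBall hx2) _
  rw [e] at h4
  refine h4.congr' ?_
  obtain ⟨δ, hδ, hd⟩ := Metric.nhds_basis_closedBall.mem_iff.1 (isOpen_ball.mem_nhds hx2)
  filter_upwards [Ioc_mem_nhdsGT hδ] with r hr
  refine setAverage_congr_fun isClosed_closedBall.measurableSet ?_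
  refine Eventually.of_forall fun y hy => ?_
  exact Set.indicator_of_mem (ball_subset_closedBall (hd (closedBall_subset_closedBall hr.2 hy))) _

lemma ae_pos {N : ℕ} {Ω : Set (Euc N)} {u : Euc N → ℝ} {c : ℝ} (hc : 0 < c)
    (hΩo : IsOpen Ω) (hΩc : IsConnected Ω)
    (hu : LocallyIntegrableOn u Ω volume)
    (hV : LocallyIntegrableOn (fun x => ‖x‖ ^ (-2 : ℝ) * u x) Ω volume)
    (hpos : ∀ᵐ x ∂volume, x ∈ Ω → 0 ≤ u x)
    (hne : ¬ (∀ᵐ x ∂volume, x ∈ Ω → u x = 0))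
    (hsup : ∀ φ : Euc N → ℝ, IsTestFun Ω φ → (∀ x, 0 ≤ φ x) →
        0 ≤ ∫ x in Ω, u x * (-(lap φ x) - c * ‖x‖ ^ (-2 : ℝ) * φ x)) :
    ∀ᵐ x ∂volume, x ∈ Ω → 0 < u x := by
  have hleb := leb_points hΩo hu
  -- the good zero points
  have good : ∀ x ∈ Ω, (x ∈ Ω → Tendsto (fun r => ⨍ y in closedBall x r, |u y|) (𝓝[>] 0) (𝓝 |u x|)) →
      u x = 0 → ∀ R, 0 < R → closedBall x R ⊆ Ω → ∀ᵐ y ∂volume, y ∈ ball x R → u y = 0 := by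
    intro x hx h h0 R hR hB
    refine mean_zero hc hΩo hu hV hpos hsup hR hB ?_
    simpa [h0] using h hx
  by_contra hcon
  apply hne
  set Z : Set (Euc N) := {x | ∃ r > 0, ∀ᵐ y ∂volume, y ∈ ball x r → u y = 0} with hZ
  have hZo : IsOpen Z := by
    rw [Metric.isOpen_iff]
    rintro x ⟨r, hr, h⟩
    refine ⟨r/2, by positivity, fun y hy => ⟨r/2, by positivity, ?_⟩⟩
    filter_upwards [h] with z hz hzy
    apply hz
    rw [mem_ball] at *
    linarith [dist_triangle z y x]
  have hZne : (Ω ∩ Z).Nonempty := by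
    have : ∃ᶠ x in ae volume, ¬ (x ∈ Ω → 0 < u x) := not_eventually.1 hcon
    obtain ⟨x, hx, hx2, hx3⟩ := (this.and_eventually (hleb.and hpos)).exists
    push Not at hx
    have h0 : u x = 0 := le_antisymm hx.2 (hx3 hx.1)
    obtain ⟨R, hR, hB⟩ := Metric.nhds_basis_closedBall.mem_iff.1 (hΩo.mem_nhds hx.1)
    exact ⟨x, hx.1, R, hR, good x hx.1 hx2 h0 R hR hB⟩
  have hsub : Ω ⊆ Z := by
    refine hΩc.isPreconnected.subset_of_closure_inter_subset hZo hZne ?_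
    rintro a ⟨haZ, haΩ⟩
    obtain ⟨R, hR, hB⟩ := Metric.nhds_basis_closedBall.mem_iff.1 (hΩo.mem_nhds haΩ)
    obtain ⟨z, hz, hzZ⟩ := Metric.mem_closure_iff.1 haZ (R/2) (by positivity)
    obtain ⟨r, hr, hzr⟩ := hz
    set U := ball z r ∩ ball a (R/2)
    have hU : IsOpen U := isOpen_ball.inter isOpen_ball
    have hUz : z ∈ U := ⟨mem_ball_self hr, by rw [mem_ball, dist_comm]; exact hzZ⟩
    have hUpos : 0 < volume U := hU.measure_pos _ ⟨z, hUz⟩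
    have hfreq : ∃ᶠ y in ae volume, y ∈ U := by
      intro h
      exact hUpos.ne' (by simpa [ae_iff] using h)
    obtain ⟨y, hyU, hy1, hy2⟩ := (hfreq.and_eventually (hleb.and hzr)).exists
    have hya : dist y a < R / 2 := hyU.2
    have hBy : closedBall y (R/2) ⊆ Ω := by
      refine Set.Subset.trans ?_ hB
      exact closedBall_subset_closedBall' (by linarith)
    have hyΩ : y ∈ Ω := hBy (mem_closedBall_self (by positivity))
    have h5 := good y hyΩ hy1 (hy2 hyU.1) (R/2) (by positivity) hBy
    refine ⟨R/2 - dist y a, by linarith, ?_⟩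
    filter_upwards [h5] with w hw hwa
    apply hw
    rw [mem_ball] at *
    rw [dist_comm y a] at hwa
    linarith [dist_triangle w a y]
  rw [ae_iff]
  refine measure_null_of_locally_null _ fun a ha => ?_
  have haΩ : a ∈ Ω := by
    by_contra h
    exact ha fun h' => absurd h' h
  obtain ⟨r, hr, h⟩ := hsub haΩ
  refine ⟨_, inter_mem_nhdsWithin _ (ball_mem_nhds a hr), ?_⟩
  refine measure_mono_null ?_ (ae_iff.1 h)
  rintro x ⟨hx1, hx2⟩ hx3
  exact hx1 fun _ => hx3 hx2

def cv {N : ℕ} (f ρ : Euc N → ℝ) (x : Euc N) : ℝ := ∫ y, f y * ρ (x - y)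

lemma cv_eq {N : ℕ} (f ρ : Euc N → ℝ) :
    cv f ρ = convolution f ρ (ContinuousLinearMap.mul ℝ ℝ) volume := by
  ext x; simp [cv, convolution_def]

lemma cv_contDiff {N : ℕ} {f ρ : Euc N → ℝ} (hf : Integrable f) (h : ContDiff ℝ (⊤ : ℕ∞) ρ)
    (hc : HasCompactSupport ρ) : ContDiff ℝ (⊤ : ℕ∞) (cv f ρ) := by
  rw [cv_eq]
  exact hc.contDiff_convolution_right _ hf.locallyIntegrable h

lemma cv_pd {N : ℕ} {f ρ : Euc N → ℝ} (hf : Integrable f) (h : ContDiff ℝ (⊤ : ℕ∞) ρ)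
    (hc : HasCompactSupport ρ) (i : Fin N) : pd i (cv f ρ) = cv f (pd i ρ) := by
  ext x
  have h1 : ContDiff ℝ 1 ρ := h.of_le (by exact_mod_cast le_top)
  have := (hc.hasFDerivAt_convolution_right (ContinuousLinearMap.mul ℝ ℝ) (μ := volume)
    hf.locallyIntegrable h1 x).fderiv
  rw [cv_eq, cv_eq]
  unfold pd
  rw [this, convolution_precompR_apply _ hf.locallyIntegrable (hc.fderiv ℝ)
    (h1.continuous_fderiv one_ne_zero)]

lemma lap_refl {N : ℕ} {ρ : Euc N → ℝ} (h : ContDiff ℝ (⊤ : ℕ∞) ρ) (x y : Euc N) :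
    lap (fun y => ρ (x - y)) y = lap ρ (x - y) := by
  have a : ∀ (σ : Euc N → ℝ) (_ : ContDiff ℝ (⊤ : ℕ∞) σ) (i : Fin N),
      pd i (fun y => σ (x - y)) = fun y => - pd i σ (x - y) := by
    intro σ hσ i
    ext z
    have h1 := (hσ.differentiable (by simp) (x - z)).hasFDerivAt.comp z
      ((hasFDerivAt_id z).const_sub x)
    unfold pd
    have := h1.fderiv
    simp only [Function.comp_def, id] at this
    rw [this]
    simp
  have hs : ContDiff ℝ (⊤ : ℕ∞) (fun y => ρ (x - y)) := h.comp (contDiff_const.sub contDiff_id)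
  rw [lap_eq hs, lap_eq h]
  refine Finset.sum_congr rfl fun i _ => ?_
  rw [a ρ h i]
  have := a _ (pd_contDiff i h) i
  have e : pd i (fun y => - pd i ρ (x - y)) y = - pd i (fun y => pd i ρ (x - y)) y := by
    unfold pd; rw [fderiv_fun_neg]; rfl
  rw [e, this, neg_neg]

lemma refl_compact {N : ℕ} {ρ : Euc N → ℝ} (hc : HasCompactSupport ρ) (x : Euc N) :
    HasCompactSupport (fun y => ρ (x - y)) :=
  hc.comp_homeomorph (Homeomorph.subLeft x)

lemma cv_lap {N : ℕ} {f ρ : Euc N → ℝ} (hf : Integrable f) (h : ContDiff ℝ (⊤ : ℕ∞) ρ)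
    (hc : HasCompactSupport ρ) (x : Euc N) :
    lap (cv f ρ) x = ∫ y, f y * lap (fun y => ρ (x - y)) y := by
  rw [lap_eq (cv_contDiff hf h hc)]
  simp_rw [cv_pd hf h hc, cv_pd hf (pd_contDiff _ h) (pd_compact _ hc), lap_refl h, lap_eq h,
    Finset.mul_sum, cv]
  rw [integral_finsetSum]
  intro i _
  exact int_mul hf ((pd_contDiff i (pd_contDiff i h)).continuous.comp (continuous_const.sub continuous_id))
    (refl_compact (pd_compact i (pd_compact i hc)) x)

lemma cc_int {N : ℕ} {h : Euc N → ℝ} (hh : Continuous h) (hc : HasCompactSupport h) : Integrable h :=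
  hh.integrable_of_hasCompactSupport hc

/-- smooth Picone-type inequality -/
lemma picone {N : ℕ} {v φ : Euc N → ℝ} {ε : ℝ} (hε : 0 < ε) (hv : ContDiff ℝ (⊤ : ℕ∞) v)
    (hv0 : ∀ x, 0 ≤ v x) (hφ : ContDiff ℝ (⊤ : ℕ∞) φ) (hc : HasCompactSupport φ) :
    ∫ x, -(lap v x) * (φ x ^ 2 / (v x + ε)) ≤ ∫ x, ∑ i, (pd i φ x) ^ 2 := by
  have hw : ∀ x, v x + ε ≠ 0 := fun x => (add_pos_of_nonneg_of_pos (hv0 x) hε).ne'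
  set η : Euc N → ℝ := fun x => φ x ^ 2 / (v x + ε) with hη
  have hηs : ContDiff ℝ (⊤ : ℕ∞) η := (hφ.pow 2).div (hv.add contDiff_const) hw
  have hηc : HasCompactSupport η := by
    refine hc.mono ?_
    intro x hx h
    apply hx
    simp [hη, h]
  have hint : ∀ i, Integrable (fun x => (pd i φ x) ^ 2) := fun i =>
    cc_int ((pd_contDiff i hφ).continuous.pow 2)
      ((pd_compact i hc).comp_left (g := fun t : ℝ => t ^ 2) (by simp))
  have hi1 : ∀ i, Integrable (fun x => pd i (pd i v) x * η x) := fun i =>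
    cc_int ((pd_contDiff i (pd_contDiff i hv)).continuous.mul hηs.continuous) hηc.mul_left
  have hi2 : ∀ i, Integrable (fun x => pd i v x * pd i η x) := fun i =>
    cc_int ((pd_contDiff i hv).continuous.mul (pd_contDiff i hηs).continuous)
      (pd_compact i hηc).mul_left
  have hi3 : ∀ i, Integrable (fun x => pd i v x * η x) := fun i =>
    cc_int ((pd_contDiff i hv).continuous.mul hηs.continuous) hηc.mul_left
  have ibp : ∀ i, ∫ x, pd i v x * pd i η x = - ∫ x, pd i (pd i v) x * η x := fun i =>
    integral_mul_fderiv_eq_neg_fderiv_mul_of_integrable (hi1 i) (hi2 i) (hi3 i)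
      (fun x _ => (pd_contDiff i hv).differentiable (by simp) x)
      (fun x _ => hηs.differentiable (by simp) x)
  have e : ∫ x, -(lap v x) * η x = ∑ i, ∫ x, pd i v x * pd i η x := by
    simp_rw [ibp, lap_eq hv]
    rw [Finset.sum_neg_distrib, ← integral_finsetSum _ fun i _ => hi1 i, ← integral_neg]
    congr 1; ext x; rw [neg_mul, Finset.sum_mul]
  rw [e, integral_finsetSum _ fun i _ => hint i]
  refine Finset.sum_le_sum fun i _ => integral_mono (hi2 i) (hint i) fun x => ?_
  have hpd : pd i η x = 2 * φ x * pd i φ x / (v x + ε) - φ x ^ 2 * pd i v x / (v x + ε) ^ 2 := by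
    have d1 := ((hφ.differentiable (by simp) x).hasFDerivAt)
    have d2 := ((hv.differentiable (by simp) x).hasFDerivAt).add_const ε
    have d3 := ((d1.pow 2).mul ((hasDerivAt_inv (hw x)).comp_hasFDerivAt x d2)).fderiv
    have : η = (fun x => φ x ^ 2) * ((fun x => x⁻¹) ∘ fun x => v x + ε) := by
      ext z; simp [hη, div_eq_mul_inv]
    unfold pd
    rw [this]
    erw [d3]
    simp
    have := hw x
    field_simp
    ring
  simp only [hpd]
  have h2 : 0 ≤ (pd i φ x - φ x * pd i v x / (v x + ε)) ^ 2 := sq_nonneg _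
  have := hw x
  have e2 : pd i v x * (2 * φ x * pd i φ x / (v x + ε) - φ x ^ 2 * pd i v x / (v x + ε) ^ 2)
      = pd i φ x ^ 2 - (pd i φ x - φ x * pd i v x / (v x + ε)) ^ 2 := by
    field_simp
    ring
  linarith

lemma grad_sq {N : ℕ} {φ : Euc N → ℝ} (hφ : ContDiff ℝ (⊤ : ℕ∞) φ) (x : Euc N) :
    ‖gradient φ x‖ ^ 2 = ∑ i, (pd i φ x) ^ 2 := by
  rw [EuclideanSpace.real_norm_sq_eq]
  refine Finset.sum_congr rfl fun i _ => ?_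
  have h : inner ℝ (gradient φ x) (ee i) = fderiv ℝ φ x (ee i) := by
    unfold gradient
    rw [InnerProductSpace.toDual_symm_apply]
  rw [EuclideanSpace.inner_single_right] at h
  unfold pd
  rw [← h]; simp

lemma cv_nonneg {N : ℕ} {f ρ : Euc N → ℝ} (h1 : ∀ x, 0 ≤ f x) (h2 : ∀ x, 0 ≤ ρ x) (x : Euc N) :
    0 ≤ cv f ρ x := integral_nonneg fun y => mul_nonneg (h1 y) (h2 _)

lemma AP_smooth {N : ℕ} {Ω : Set (Euc N)} {u : Euc N → ℝ} {c : ℝ}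
    (hΩo : IsOpen Ω)
    (hu : LocallyIntegrableOn u Ω volume)
    (hV : LocallyIntegrableOn (fun x => ‖x‖ ^ (-2 : ℝ) * u x) Ω volume)
    (hpos : ∀ᵐ x ∂volume, x ∈ Ω → 0 ≤ u x)
    (hsup : ∀ φ : Euc N → ℝ, IsTestFun Ω φ → (∀ x, 0 ≤ φ x) →
        0 ≤ ∫ x in Ω, u x * (-(lap φ x) - c * ‖x‖ ^ (-2 : ℝ) * φ x))
    {φ : Euc N → ℝ} (hφ : IsTestFun Ω φ) {δ : ℝ}
    (hK : IsCompact (cthickening δ (tsupport φ)))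
    (hKΩ : cthickening δ (tsupport φ) ⊆ Ω)
    {ρ : Euc N → ℝ} (hρ : ContDiff ℝ (⊤ : ℕ∞) ρ) (hρ0 : ∀ x, 0 ≤ ρ x)
    (hρs : tsupport ρ ⊆ closedBall 0 δ) {ε : ℝ} (hε : 0 < ε) :
    Integrable (fun x => c * cv (cutF (cthickening δ (tsupport φ)) (fun x => ‖x‖ ^ (-2 : ℝ) * u x)) ρ x
      * (φ x ^ 2 / (cv (cutF (cthickening δ (tsupport φ)) u) ρ x + ε))) ∧
    ∫ x, c * cv (cutF (cthickening δ (tsupport φ)) (fun x => ‖x‖ ^ (-2 : ℝ) * u x)) ρ x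
      * (φ x ^ 2 / (cv (cutF (cthickening δ (tsupport φ)) u) ρ x + ε))
      ≤ ∫ x in Ω, ‖gradient φ x‖ ^ 2 := by
  set K := cthickening δ (tsupport φ) with hKdef
  set f := cutF K u
  set g := cutF K (fun x => ‖x‖ ^ (-2 : ℝ) * u x)
  have hf : Integrable f := cutF_int hK hKΩ hu
  have hg : Integrable g := cutF_int hK hKΩ hV
  have hρc : HasCompactSupport ρ :=
    (isCompact_closedBall 0 δ).of_isClosed_subset (isClosed_tsupport _) hρs
  have hfs := cv_contDiff hf hρ hρc
  have hgs := cv_contDiff hg hρ hρc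
  have hf0 := cv_nonneg (cutF_nonneg K u) hρ0
  have hw : ∀ x, cv f ρ x + ε ≠ 0 := fun x => (add_pos_of_nonneg_of_pos (hf0 x) hε).ne'
  have hηs : Continuous (fun x => φ x ^ 2 / (cv f ρ x + ε)) :=
    (hφ.1.continuous.pow 2).div (hfs.continuous.add continuous_const) hw
  have hηc : HasCompactSupport (fun x => φ x ^ 2 / (cv f ρ x + ε)) := by
    refine hφ.2.1.mono ?_
    intro x hx h
    apply hx
    simp [h]
  have hI1 : Integrable (fun x => c * cv g ρ x * (φ x ^ 2 / (cv f ρ x + ε))) :=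
    cc_int ((continuous_const.mul hgs.continuous).mul hηs) hηc.mul_left
  refine ⟨hI1, ?_⟩
  have hG : ∫ x in Ω, ‖gradient φ x‖ ^ 2 = ∫ x, ∑ i, (pd i φ x) ^ 2 := by
    simp_rw [grad_sq hφ.1]
    refine setIntegral_eq_integral_of_forall_compl_eq_zero fun x hx => ?_
    refine Finset.sum_eq_zero fun i _ => ?_
    have : x ∉ tsupport (fderiv ℝ φ) := fun h => hx (hφ.2.2 (tsupport_fderiv_subset ℝ h))
    unfold pd
    rw [image_eq_zero_of_notMem_tsupport this]; simp
  rw [hG]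
  refine le_trans (integral_mono hI1 ?_ ?_) (picone hε hfs hf0 hφ.1 hφ.2.1)
  · exact cc_int ((lap_contDiff hfs).continuous.neg.mul hηs) hηc.mul_left
  · intro x
    by_cases hx : x ∈ tsupport φ
    · simp only
      refine mul_le_mul_of_nonneg_right ?_
        (div_nonneg (sq_nonneg _) (add_nonneg (hf0 x) hε.le))
      have hsup' : tsupport (fun y => ρ (x - y)) ⊆ K := by
        refine closure_minimal ?_ isClosed_cthickening
        intro y hy
        have h1 : x - y ∈ closedBall (0 : Euc N) δ := hρs (subset_tsupport _ hy)
        refine mem_cthickening_of_dist_le y x δ _ hx ?_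
        rw [dist_comm, dist_eq_norm]
        simpa using h1
      have := key_ineq hΩo hK hKΩ hu hV hpos hsup
        (ψ := fun y => ρ (x - y)) (hρ.comp (contDiff_const.sub contDiff_id)) hsup'
        (fun y => hρ0 _)
      rw [cv_lap hf hρ hρc]
      have e : cv g ρ x = ∫ y, g y * ρ (x - y) := rfl
      rw [e]
      linarith
    · simp [image_eq_zero_of_notMem_tsupport hx]

lemma fatou_aux {N : ℕ} {F : ℕ → Euc N → ℝ} {G : Euc N → ℝ} {B : ℝ≥0∞}
    (hm : ∀ n, AEMeasurable (F n) volume) (hB : ∀ n, ∫⁻ x, ENNReal.ofReal (F n x) ≤ B)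
    (hl : ∀ᵐ x ∂volume, Tendsto (fun n => F n x) atTop (𝓝 (G x))) :
    ∫⁻ x, ENNReal.ofReal (G x) ≤ B := by
  have h1 : ∫⁻ x, ENNReal.ofReal (G x) =
      ∫⁻ x, liminf (fun n => ENNReal.ofReal (F n x)) atTop := by
    refine lintegral_congr_ae ?_
    filter_upwards [hl] with x hx
    exact ((ENNReal.continuous_ofReal.tendsto _).comp hx).liminf_eq.symm
  rw [h1]
  refine (lintegral_liminf_le' fun n => (hm n).ennreal_ofReal).trans ?_
  refine (liminf_le_liminf (Eventually.of_forall hB)).trans ?_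
  simp

def bmp (N : ℕ) {δ : ℝ} (hδ : 0 < δ) (n : ℕ) : ContDiffBump (0 : Euc N) where
  rIn := δ / (2 * (n + 1))
  rOut := δ / (n + 1)
  rIn_pos := by positivity
  rIn_lt_rOut := by
    apply div_lt_div_of_pos_left hδ (by positivity)
    have : (0:ℝ) ≤ n := by positivity
    linarith

lemma bmp_tendsto {N : ℕ} {δ : ℝ} (hδ : 0 < δ) {f : Euc N → ℝ} (hf : Integrable f) :
    ∀ᵐ x ∂volume, Tendsto (fun n => cv f ((bmp N hδ n).normed volume) x) atTop (𝓝 (f x)) := by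
  have h := ContDiffBump.ae_convolution_tendsto_right_of_locallyIntegrable (μ := volume)
    (φ := bmp N hδ) (l := atTop) (K := 2) (g := f) ?_ ?_ hf.locallyIntegrable
  · filter_upwards [h] with x hx
    refine hx.congr fun n => ?_
    rw [convolution_eq_swap]
    unfold cv
    congr 1; ext y
    simp [mul_comm]
  · have := tendsto_one_div_add_atTop_nhds_zero_nat (𝕜 := ℝ)
    have := this.const_mul δ
    simpa [bmp, div_eq_mul_inv] using this
  · refine Eventually.of_forall fun n => le_of_eq ?_
    simp only [bmp]
    field_simp

lemma AP_final {N : ℕ} {Ω : Set (Euc N)} {u : Euc N → ℝ} {c : ℝ} (hc : 0 < c)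
    (hΩo : IsOpen Ω)
    (hu : LocallyIntegrableOn u Ω volume)
    (hV : LocallyIntegrableOn (fun x => ‖x‖ ^ (-2 : ℝ) * u x) Ω volume)
    (hpos : ∀ᵐ x ∂volume, x ∈ Ω → 0 < u x)
    (hsup : ∀ φ : Euc N → ℝ, IsTestFun Ω φ → (∀ x, 0 ≤ φ x) →
        0 ≤ ∫ x in Ω, u x * (-(lap φ x) - c * ‖x‖ ^ (-2 : ℝ) * φ x))
    {φ : Euc N → ℝ} (hφ : IsTestFun Ω φ) :
    ∫⁻ x, ENNReal.ofReal (c * (‖x‖ ^ (-2 : ℝ) * φ x ^ 2)) ≤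
      ENNReal.ofReal (∫ x in Ω, ‖gradient φ x‖ ^ 2) := by
  obtain ⟨δ, hδ, hKΩ⟩ := hφ.2.1.isCompact.exists_cthickening_subset_open hΩo hφ.2.2
  have hK : IsCompact (cthickening δ (tsupport φ)) := hφ.2.1.isCompact.cthickening
  have hpos' : ∀ᵐ x ∂volume, x ∈ Ω → 0 ≤ u x := hpos.mono fun x hx h => (hx h).le
  have AP := fun (n : ℕ) (ε : ℝ) (hε : 0 < ε) => AP_smooth hΩo hu hV hpos' hsup hφ hK hKΩ
    (ρ := (bmp N hδ n).normed volume) (bmp N hδ n).contDiff_normed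
    (fun x => (bmp N hδ n).nonneg_normed x) (by
      rw [ContDiffBump.tsupport_normed_eq]
      refine closedBall_subset_closedBall ?_
      simp only [bmp]
      apply div_le_self hδ.le
      have : (0:ℝ) ≤ n := by positivity
      linarith) hε
  set K := cthickening δ (tsupport φ) with hKdef
  set f := cutF K u with hfd
  set g := cutF K (fun x => ‖x‖ ^ (-2 : ℝ) * u x) with hgd
  have hf : Integrable f := cutF_int hK hKΩ hu
  have hg : Integrable g := cutF_int hK hKΩ hV
  have hf0 : ∀ x, 0 ≤ f x := cutF_nonneg _ _
  have hg0 : ∀ x, 0 ≤ g x := cutF_nonneg _ _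
  set B := ENNReal.ofReal (∫ x in Ω, ‖gradient φ x‖ ^ 2)
  have step1 : ∀ ε : ℝ, 0 < ε →
      ∫⁻ x, ENNReal.ofReal (c * g x * (φ x ^ 2 / (f x + ε))) ≤ B := by
    intro ε hε
    refine fatou_aux (F := fun n x => c * cv g ((bmp N hδ n).normed volume) x *
      (φ x ^ 2 / (cv f ((bmp N hδ n).normed volume) x + ε))) (fun n => (AP n ε hε).1.aemeasurable) ?_ ?_
    · intro n
      rw [← ofReal_integral_eq_lintegral_ofReal (AP n ε hε).1]
      · exact ENNReal.ofReal_le_ofReal (AP n ε hε).2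
      · refine Eventually.of_forall fun x => ?_
        have h1 := cv_nonneg hf0 (fun x => (bmp N hδ n).nonneg_normed (μ := volume) x) x
        have h2 := cv_nonneg hg0 (fun x => (bmp N hδ n).nonneg_normed (μ := volume) x) x
        simp only [Pi.zero_apply]
        positivity
    · filter_upwards [bmp_tendsto hδ hf, bmp_tendsto hδ hg] with x hx1 hx2
      refine (hx2.const_mul c).mul (tendsto_const_nhds.div (hx1.add_const ε) ?_)
      exact (add_pos_of_nonneg_of_pos (hf0 x) hε).ne'
  refine fatou_aux (F := fun n x => c * g x * (φ x ^ 2 / (f x + 1 / ((n:ℝ) + 1)))) ?_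
    (fun n => step1 _ (by positivity)) ?_
  · intro n
    exact (hg.aemeasurable.const_mul c).mul
      ((hφ.1.continuous.measurable.pow_const 2).aemeasurable.div (hf.aemeasurable.add_const _))
  · filter_upwards [hpos] with x hx
    by_cases hxs : x ∈ tsupport φ
    · have hxK : x ∈ K := self_subset_cthickening _ hxs
      have hux := hx (hφ.2.2 hxs)
      have e1 : f x = u x := by
        simp only [hfd, cutF, Set.indicator_of_mem hxK, abs_of_pos hux]
      have e2 : g x = ‖x‖ ^ (-2 : ℝ) * u x := by
        have : 0 ≤ ‖x‖ ^ (-2 : ℝ) * u x := by positivity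
        simp only [hgd, cutF, Set.indicator_of_mem hxK, abs_of_nonneg this]
      rw [e1, e2]
      have h0 := (tendsto_one_div_add_atTop_nhds_zero_nat (𝕜 := ℝ)).const_add (u x)
      rw [add_zero] at h0
      have := (tendsto_const_nhds (x := φ x ^ 2)).div h0 hux.ne'
      have := this.const_mul (c * (‖x‖ ^ (-2 : ℝ) * u x))
      have e3 : c * (‖x‖ ^ (-2 : ℝ) * φ x ^ 2) =
          c * (‖x‖ ^ (-2 : ℝ) * u x) * (φ x ^ 2 / u x) := by
        have := hux.ne'
        generalize ‖x‖ ^ (-2 : ℝ) = V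
        field_simp
      rw [e3]
      exact this
    · simp [image_eq_zero_of_notMem_tsupport hxs]

/-- **Remark 1.5.** If `c > μ(Ω)`, then there is no nonnegative, nontrivial `u ∈ L¹_loc(Ω)`
with `|x|⁻²u ∈ L¹_loc(Ω)` satisfying `-Δu - c|x|⁻²u ≥ 0` in `D'(Ω)`. -/
theorem nonexistence_above_hardy_constant {N : ℕ} (hN : 1 ≤ N) (Ω : Set (Euc N))
    (hΩo : IsOpen Ω) (hΩc : IsConnected Ω)
    (c : ℝ) (hc : hardyConst Ω < c) :
    ¬ ∃ u : Euc N → ℝ,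
      LocallyIntegrableOn u Ω volume ∧
      LocallyIntegrableOn (fun x => ‖x‖ ^ (-2 : ℝ) * u x) Ω volume ∧
      (∀ᵐ x ∂volume, x ∈ Ω → 0 ≤ u x) ∧
      ¬ (∀ᵐ x ∂volume, x ∈ Ω → u x = 0) ∧
      (∀ φ : Euc N → ℝ, IsTestFun Ω φ → (∀ x, 0 ≤ φ x) →
        0 ≤ ∫ x in Ω, u x * (-(lap φ x) - c * ‖x‖ ^ (-2 : ℝ) * φ x)) := by
  rintro ⟨u, hu, hV, hnn, hne, hsup⟩
  have hc0 : 0 < c := by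
    refine lt_of_le_of_lt (Real.sInf_nonneg ?_) hc
    rintro t ⟨φ, _, _, rfl⟩
    exact div_nonneg (integral_nonneg fun x => by positivity)
      (integral_nonneg fun x => by positivity)
  have hpos := ae_pos hc0 hΩo hΩc hu hV hnn hne hsup
  refine absurd hc (not_lt.2 (le_csInf ?_ ?_))
  · obtain ⟨x0, hx0⟩ := hΩc.nonempty
    obtain ⟨R, hR, hB⟩ := Metric.nhds_basis_closedBall.mem_iff.1 (hΩo.mem_nhds hx0)
    refine ⟨_, PsiF x0 R, PsiF_test x0 hR hB, ?_, rfl⟩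
    intro h
    have h1 := congrFun h x0
    simp only [PsiF, sub_self, norm_zero, Pi.zero_apply] at h1
    have := expNegInvGlue.zero_iff_nonpos.1 h1
    norm_num at this
  · rintro t ⟨φ, hφ, hφ0, rfl⟩
    have h := AP_final hc0 hΩo hu hV hpos hsup hφ
    set A := ∫ x in Ω, ‖gradient φ x‖ ^ 2 with hA
    have hA0 : 0 ≤ A := integral_nonneg fun x => by positivity
    have hD : ∫ x in Ω, ‖x‖ ^ (-2 : ℝ) * φ x ^ 2 = ∫ x, ‖x‖ ^ (-2 : ℝ) * φ x ^ 2 := by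
      refine setIntegral_eq_integral_of_forall_compl_eq_zero fun x hx => ?_
      have : x ∉ tsupport φ := fun h => hx (hφ.2.2 h)
      simp [image_eq_zero_of_notMem_tsupport this]
    rw [hD]
    have hmeas : AEStronglyMeasurable (fun x : Euc N => c * (‖x‖ ^ (-2 : ℝ) * φ x ^ 2)) volume := by
      have h1 : Measurable (fun x : Euc N => ‖x‖ ^ (-2 : ℝ)) := measurable_norm.pow_const _
      exact ((h1.mul (hφ.1.continuous.measurable.pow_const 2)).const_mul c).aestronglyMeasurable
    have hnn' : ∀ x : Euc N, 0 ≤ c * (‖x‖ ^ (-2 : ℝ) * φ x ^ 2) := fun x => by positivity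
    have hI : Integrable (fun x : Euc N => c * (‖x‖ ^ (-2 : ℝ) * φ x ^ 2)) := by
      refine ⟨hmeas, ?_⟩
      rw [hasFiniteIntegral_iff_ofReal (Eventually.of_forall hnn')]
      exact h.trans_lt ENNReal.ofReal_lt_top
    have hle : c * ∫ x, ‖x‖ ^ (-2 : ℝ) * φ x ^ 2 ≤ A := by
      rw [← integral_const_mul]
      rw [← ofReal_integral_eq_lintegral_ofReal hI (Eventually.of_forall hnn')] at h
      exact (ENNReal.ofReal_le_ofReal_iff hA0).1 h
    have hDpos : 0 < ∫ x, ‖x‖ ^ (-2 : ℝ) * φ x ^ 2 := by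
      refine lt_of_le_of_ne (integral_nonneg fun x => by positivity) fun h0 => hφ0 ?_
      have h1 : ∫ x, c * (‖x‖ ^ (-2 : ℝ) * φ x ^ 2) = 0 := by
        rw [integral_const_mul, ← h0, mul_zero]
      have h2 := (integral_eq_zero_iff_of_nonneg hnn' hI).1 h1
      have : Nonempty (Fin N) := ⟨⟨0, hN⟩⟩
      have : Nontrivial (Euc N) := inferInstance
      have h3 : ∀ᵐ x : Euc N ∂volume, x ≠ 0 := by
        rw [ae_iff]; simp
      refine (Continuous.ae_eq_iff_eq volume hφ.1.continuous continuous_const).1 ?_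
      filter_upwards [h2, h3] with x hx hx0
      have hn : ‖x‖ ^ (-2 : ℝ) ≠ 0 := (Real.rpow_pos_of_pos (norm_pos_iff.2 hx0) _).ne'
      have := (mul_eq_zero.1 hx).resolve_left hc0.ne'
      exact pow_eq_zero_iff (two_ne_zero) |>.1 ((mul_eq_zero.1 this).resolve_left hn)
    rw [le_div_iff₀ hDpos]
    exact hle
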